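/- arXiv:1008.3475 — 2 statements merged into one kernel-verified Lean document; each statement's English description precedes it below -/
import Mathlib

section
/- For all integers n ≥ 0 and α ≥ 0, pod(3^{2α+3}·n + (23·3^{2α+2} + 1)/8) ≡ 0 (mod 3). -/
/-- `pod n`: number of partitions of `n` in which odd parts are not repeated. -/
noncomputable def pod (n : ℕ) : ℕ :=
  Nat.card {p : n.Partition // ∀ i, Odd i → p.parts.count i ≤ 1}

open PowerSeries

/-! ### Shanks's finite form of Gauss's identity for `∑ q ^ (s (s + 1) / 2)` -/

section FiniteIdentity

variable {R : Type*} [CommRing R] {q : R} {Q : ℕ → R}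

theorem shanks_telescope (hQ : ∀ n, (1 - q ^ (2 * n + 2)) * Q (n + 1) = (1 - q ^ (2 * n + 1)) * Q n)
    (n m : ℕ) :
    (1 - q ^ (2 * n + 2)) * ∑ s ∈ Finset.range m, Q s * q ^ (s * (2 * n + 3)) =
      (1 - q ^ (2 * n + 1)) * ∑ s ∈ Finset.range m, Q s * q ^ (s * (2 * n + 1)) +
        (1 - q ^ (2 * m)) * Q m * q ^ (m * (2 * n + 1)) := by
  induction m with
  | zero => simp
  | succ m ih =>
    rw [Finset.sum_range_succ, Finset.sum_range_succ, mul_add, ih]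
    linear_combination (-q ^ ((m + 1) * (2 * n + 1))) * hQ m

/-- Multiplying the finite product by a partial theta sum leaves a sum whose terms with `s ≠ 0`
are divisible by `q ^ (2 * n + 1)`. -/
theorem shanks_identity [IsDomain R] (hq : ∀ n, 1 - q ^ (2 * n + 2) ≠ 0) (h0 : Q 0 = 1)
    (hQ : ∀ n, (1 - q ^ (2 * n + 2)) * Q (n + 1) = (1 - q ^ (2 * n + 1)) * Q n) (n : ℕ) :
    Q n * ∑ s ∈ Finset.range (2 * n + 1), q ^ (s * (s + 1) / 2) =
      ∑ s ∈ Finset.range (n + 1), Q s * q ^ (s * (2 * n + 1)) := by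
  induction n with
  | zero => simp [h0]
  | succ n ih =>
    apply mul_left_cancel₀ (hq n)
    have h1 : (2 * n + 1) * (2 * n + 1 + 1) / 2 = (n + 1) * (2 * n + 1) :=
      Nat.div_eq_of_eq_mul_left two_pos (by ring)
    have h2 : (2 * n + 1 + 1) * (2 * n + 1 + 1 + 1) / 2 = (n + 1) * (2 * n + 3) :=
      Nat.div_eq_of_eq_mul_left two_pos (by ring)
    rw [show 2 * (n + 1) + 1 = 2 * n + 1 + 1 + 1 by ring, Finset.sum_range_succ,
      Finset.sum_range_succ, h1, h2, Finset.sum_range_succ _ (n + 1),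
      show 2 * n + 1 + 1 + 1 = 2 * n + 3 by ring]
    linear_combination (∑ s ∈ Finset.range (2 * n + 1), q ^ (s * (s + 1) / 2)
        + q ^ ((n + 1) * (2 * n + 1)) + q ^ ((n + 1) * (2 * n + 3))) * hQ n
      + (1 - q ^ (2 * n + 1)) * ih - shanks_telescope hQ n (n + 1)
      - (q ^ ((n + 1) * (2 * n + 1)) + q ^ ((n + 1) * (2 * n + 3))) * hQ n

end FiniteIdentity

/-! ### The generating function -/

/-- The power series `∑ pod n * X ^ n` modulo `3`. -/
noncomputable def podSeries : (ZMod 3)⟦X⟧ := mk fun n => (pod n : ZMod 3)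

open Classical in
/-- The power series `∑ (-X) ^ (s (s + 1) / 2)` modulo `3`; an exponent `n` is triangular exactly
when `8 * n + 1` is a square. -/
noncomputable def psiNeg : (ZMod 3)⟦X⟧ := mk fun n => if IsSquare (8 * n + 1) then (-1) ^ n else 0

open Classical in
/-- The indicator that `c` copies of the part `i` are allowed. -/
noncomputable def podChar (i c : ℕ) : ZMod 3 := if Odd i → c ≤ 1 then 1 else 0

theorem genFun_podChar : Nat.Partition.genFun podChar = podSeries := by
  classical
  ext n
  simp only [Nat.Partition.coeff_genFun, podSeries, coeff_mk, pod, Nat.card_eq_fintype_card,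
    Fintype.card_subtype, Finset.card_filter, Nat.cast_sum, Nat.cast_ite, Nat.cast_one,
    Nat.cast_zero, Finsupp.prod, podChar, Multiset.toFinsupp_support]
  refine Finset.sum_congr rfl fun p _ => ?_
  rw [Finset.prod_boole]
  refine if_congr ⟨fun h i hi => ?_, fun h i _ => by simpa using h i⟩ rfl rfl
  by_cases hp : i ∈ p.parts
  · simpa using h i (Multiset.mem_toFinset.2 hp) hi
  · simp [Multiset.count_eq_zero_of_notMem hp]

section Topology

open scoped PowerSeries.WithPiTopology
open Filter Topology

local instance : TopologicalSpace (ZMod 3) := ⊥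
local instance : DiscreteTopology (ZMod 3) := ⟨rfl⟩

/-- The generating function for the number of copies of the part `i + 1`. -/
noncomputable def podFactor (i : ℕ) : (ZMod 3)⟦X⟧ :=
  1 + ∑' j, podChar (i + 1) (j + 1) • X ^ ((i + 1) * (j + 1))

theorem podFactor_two_mul (n : ℕ) : podFactor (2 * n) = 1 - (-X) ^ (2 * n + 1) := by
  have ho : Odd (2 * n + 1) := odd_two_mul_add_one n
  rw [podFactor, tsum_eq_single 0, ho.neg_pow]
  · simp [podChar]
  · intro j hj
    simp [podChar, ho, hj]

theorem one_sub_mul_podFactor (n : ℕ) :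
    (1 - (-X) ^ (2 * n + 2)) * podFactor (2 * n + 1) = 1 := by
  have he : Even (2 * n + 2) := ⟨n + 1, by ring⟩
  have ho : ¬ Odd (2 * n + 2) := Nat.not_odd_iff_even.2 he
  have h0 : ((X : (ZMod 3)⟦X⟧) ^ (2 * n + 2)).constantCoeff = 0 := by simp
  have h : podFactor (2 * n + 1) = ∑' j, (X ^ (2 * n + 2)) ^ j := by
    rw [podFactor, (WithPiTopology.summable_pow_of_constantCoeff_eq_zero h0).tsum_eq_zero_add]
    simp [podChar, ho, pow_mul]
  rw [h, he.neg_pow, WithPiTopology.one_sub_mul_tsum_pow_of_constantCoeff_eq_zero h0]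

theorem tendsto_partialSum_psiNeg :
    Tendsto (fun n => ∑ s ∈ Finset.range (2 * n + 1), (-X : (ZMod 3)⟦X⟧) ^ (s * (s + 1) / 2))
      atTop (𝓝 psiNeg) := by
  rw [WithPiTopology.tendsto_iff_coeff_tendsto]
  refine fun d => tendsto_atTop_of_eventually_const (i₀ := d) fun n hn => ?_
  have hc (s : ℕ) : coeff d ((-X : (ZMod 3)⟦X⟧) ^ (s * (s + 1) / 2)) =
      if d = s * (s + 1) / 2 then (-1) ^ d else 0 := by
    rw [neg_pow, show (-1 : (ZMod 3)⟦X⟧) = C (-1) by simp, ← map_pow, coeff_C_mul, coeff_X_pow]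
    split_ifs with h
    · simp [← h]
    · simp
  have ht (s : ℕ) : d = s * (s + 1) / 2 ↔ 8 * d + 1 = (2 * s + 1) * (2 * s + 1) := by
    have := Nat.div_mul_cancel (Nat.even_mul_succ_self s).two_dvd
    constructor <;> intro h <;> nlinarith
  simp only [map_sum, hc, psiNeg, coeff_mk]
  split_ifs with h
  · obtain ⟨r, hr⟩ := h
    obtain ⟨s, rfl⟩ : Odd r := by
      have : Odd (r * r) := hr ▸ ⟨4 * d, by ring⟩
      exact (Nat.odd_mul.1 this).1
    rw [Finset.sum_eq_single s]
    · rw [if_pos ((ht s).2 hr)]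
    · intro t _ hts
      rw [if_neg]
      intro h
      have := Nat.mul_self_inj.1 (hr.symm.trans ((ht t).1 h))
      omega
    · intro hs
      rw [Finset.mem_range, not_lt] at hs
      nlinarith
  · exact Finset.sum_eq_zero fun s _ => if_neg fun hs => h ⟨_, (ht s).1 hs⟩

/-- Gauss's identity: `podSeries` is the inverse of `psiNeg`. -/
theorem podSeries_mul_psiNeg : podSeries * psiNeg = 1 := by
  set Q : ℕ → (ZMod 3)⟦X⟧ := fun n => ∏ i ∈ Finset.range (2 * n), podFactor i
  have hQ (n : ℕ) : (1 - (-X) ^ (2 * n + 2)) * Q (n + 1) = (1 - (-X) ^ (2 * n + 1)) * Q n := by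
    simp only [Q, mul_add, mul_one, Finset.prod_range_succ]
    rw [podFactor_two_mul]
    linear_combination ((1 - (-X) ^ (2 * n + 1)) * Q n) * one_sub_mul_podFactor n
  have hq (n : ℕ) : (1 : (ZMod 3)⟦X⟧) - (-X) ^ (2 * n + 2) ≠ 0 :=
    left_ne_zero_of_mul_eq_one (one_sub_mul_podFactor n)
  have hQlim : Tendsto Q atTop (𝓝 podSeries) := by
    rw [← genFun_podChar]
    exact (Nat.Partition.hasProd_genFun podChar).tendsto_prod_nat.comp
      (tendsto_id.const_mul_atTop' two_pos)
  have hlim : Tendsto (fun n => ∑ s ∈ Finset.range (n + 1), Q s * (-X) ^ (s * (2 * n + 1)))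
      atTop (𝓝 1) := by
    rw [WithPiTopology.tendsto_iff_coeff_tendsto]
    refine fun d => tendsto_atTop_of_eventually_const (i₀ := d) fun n hn => ?_
    rw [Finset.sum_range_succ', map_add, map_sum, Finset.sum_eq_zero]
    · simp [Q]
    · intro s _
      rw [neg_pow, mul_left_comm, ← mul_assoc, coeff_mul_X_pow', if_neg]
      nlinarith
  refine tendsto_nhds_unique (hQlim.mul tendsto_partialSum_psiNeg) (hlim.congr fun n => ?_)
  exact (shanks_identity hq (by simp [Q]) hQ n).symm

end Topology

/-! ### Trisection of power series -/

section Trisection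

variable {R : Type*} [CommRing R]

/-- The series formed by the coefficients of `F` at exponents congruent to `r` modulo `3`. -/
noncomputable def trisect (r : ℕ) (F : R⟦X⟧) : R⟦X⟧ := mk fun n => coeff (3 * n + r) F

@[simp]
theorem coeff_trisect (r n : ℕ) (F : R⟦X⟧) : coeff n (trisect r F) = coeff (3 * n + r) F :=
  coeff_mk _ _

theorem eq_sum_expand_trisect (F : R⟦X⟧) :
    F = expand 3 three_ne_zero (trisect 0 F) + X * expand 3 three_ne_zero (trisect 1 F)
      + X ^ 2 * expand 3 three_ne_zero (trisect 2 F) := by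
  ext n
  rw [map_add, map_add, ← pow_one X, ← pow_mul, coeff_X_pow_mul', coeff_X_pow_mul']
  simp only [coeff_expand, coeff_trisect]
  obtain ⟨m, rfl | rfl | rfl⟩ : ∃ m, n = 3 * m ∨ n = 3 * m + 1 ∨ n = 3 * m + 2 :=
    ⟨n / 3, by omega⟩
  · have h1 : ¬ (1 ≤ 3 * m ∧ 3 ∣ 3 * m - 1) := by omega
    have h2 : ¬ (1 * 2 ≤ 3 * m ∧ 3 ∣ 3 * m - 1 * 2) := by omega
    simp [← ite_and, h1, h2]
  · have h0 : ¬ 3 ∣ 3 * m + 1 := by omega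
    have h2 : ¬ (1 ≤ 3 * m ∧ 3 ∣ 3 * m - 1) := by omega
    simp [h0]
    exact fun h h' => (h2 ⟨h, h'⟩).elim
  · have h0 : ¬ 3 ∣ 3 * m + 2 := by omega
    have h1 : ¬ 3 ∣ 3 * m + 1 := by omega
    simp [h0, h1]

theorem trisect_of_eq {F A B D : R⟦X⟧}
    (h : F = expand 3 three_ne_zero A + X * expand 3 three_ne_zero B
      + X ^ 2 * expand 3 three_ne_zero D) : trisect 1 F = B ∧ trisect 2 F = D := by
  subst h
  constructor <;> ext n <;>
    rw [coeff_trisect, map_add, map_add, ← pow_one X, ← pow_mul, coeff_X_pow_mul',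
      coeff_X_pow_mul']
  · have h0 : ¬ 3 ∣ 3 * n + 1 := by omega
    have h2 : ¬ (1 ≤ 3 * n ∧ 3 ∣ 3 * n - 1) := by omega
    simp [coeff_expand, h0]
    exact fun h h' => (h2 ⟨h, h'⟩).elim
  · have h0 : ¬ 3 ∣ 3 * n + 2 := by omega
    have h1 : ¬ 3 ∣ 3 * n + 1 := by omega
    simp [coeff_expand, h0, h1]

theorem trisect_mul_expand (F H : R⟦X⟧) :
    trisect 1 (F * expand 3 three_ne_zero H) = trisect 1 F * H ∧
      trisect 2 (F * expand 3 three_ne_zero H) = trisect 2 F * H := by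
  apply trisect_of_eq (A := trisect 0 F * H)
  simp only [map_mul]
  linear_combination expand 3 three_ne_zero H * eq_sum_expand_trisect F

end Trisection

theorem expand_three_eq_pow (F : (ZMod 3)⟦X⟧) : expand 3 three_ne_zero F = F ^ 3 := by
  have : Fact (Nat.Prime 3) := ⟨Nat.prime_three⟩
  rw [← MvPowerSeries.map_frobenius_expand 3 three_ne_zero, ZMod.frobenius_zmod]
  simp [expand]

theorem trisect_one_psiNeg : trisect 1 psiNeg = -expand 3 three_ne_zero psiNeg := by
  ext n
  rw [coeff_trisect, map_neg, coeff_expand]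
  simp only [psiNeg, coeff_mk]
  by_cases h : 3 ∣ n
  · obtain ⟨m, rfl⟩ := h
    have hs : IsSquare (8 * (3 * (3 * m) + 1) + 1) ↔ IsSquare (8 * m + 1) := by
      constructor
      · rintro ⟨r, hr⟩
        obtain ⟨t, rfl⟩ : 3 ∣ r := by
          have h3 : 3 ∣ r * r := ⟨24 * m + 3, by omega⟩
          exact (Nat.prime_three.dvd_mul.1 h3).elim id id
        exact ⟨t, by linarith⟩
      · rintro ⟨t, ht⟩
        exact ⟨3 * t, by linarith⟩
    rw [if_pos (dvd_mul_right 3 m), Nat.mul_div_cancel_left m three_pos]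
    simp only [hs]
    split_ifs
    · rw [show 3 * (3 * m) + 1 = m + (2 * (4 * m) + 1) by ring, pow_add, pow_succ, pow_mul]
      simp
    · simp
  · rw [if_neg h, if_neg, neg_zero]
    rintro ⟨r, hr⟩
    obtain ⟨t, rfl⟩ : 3 ∣ r := by
      have h3 : 3 ∣ r * r := ⟨8 * n + 3, by omega⟩
      exact (Nat.prime_three.dvd_mul.1 h3).elim id id
    have : 8 * n + 3 = 3 * (t * t) := by linarith
    omega

theorem trisect_two_psiNeg : trisect 2 psiNeg = 0 := by
  ext n
  simp only [coeff_trisect, psiNeg, coeff_mk, map_zero, ite_eq_right_iff]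
  rintro ⟨r, hr⟩
  have h := congrArg (· % 3) hr
  simp only [Nat.mul_mod r r] at h
  have : r % 3 < 3 := Nat.mod_lt _ three_pos
  interval_cases r % 3 <;> omega

theorem trisect_two_psiNeg_sq : trisect 2 (psiNeg ^ 2) = expand 3 three_ne_zero (psiNeg ^ 2) := by
  have h := eq_sum_expand_trisect psiNeg
  rw [trisect_one_psiNeg, trisect_two_psiNeg, map_zero, mul_zero, add_zero] at h
  set A := trisect 0 psiNeg
  refine (trisect_of_eq (A := A ^ 2) (B := -2 * A * expand 3 three_ne_zero psiNeg) ?_).2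
  conv_lhs => rw [h]
  simp only [map_mul, map_pow, map_neg, map_ofNat]
  ring

theorem trisect_two_podSeries :
    trisect 2 podSeries = psiNeg ^ 2 * expand 3 three_ne_zero psiNeg := by
  have h : podSeries = psiNeg ^ 2 * expand 3 three_ne_zero podSeries := by
    rw [expand_three_eq_pow]
    linear_combination (-podSeries * (podSeries * psiNeg + 1)) * podSeries_mul_psiNeg
  rw [h, (trisect_mul_expand _ _).2, trisect_two_psiNeg_sq, map_pow, expand_three_eq_pow]
  linear_combination psiNeg ^ 5 * podSeries_mul_psiNeg

theorem trisect_two_trisect_two_podSeries :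
    trisect 2 (trisect 2 podSeries) = psiNeg * expand 3 three_ne_zero (psiNeg ^ 2) := by
  rw [trisect_two_podSeries, (trisect_mul_expand _ _).2, trisect_two_psiNeg_sq, mul_comm]

theorem pod_twentyseven_mul_add_twentysix (n : ℕ) : (pod (27 * n + 26) : ZMod 3) = 0 := by
  have h : trisect 2 (trisect 2 (trisect 2 podSeries)) = 0 := by
    rw [trisect_two_trisect_two_podSeries, (trisect_mul_expand _ _).2, trisect_two_psiNeg, zero_mul]
  have hn := congrArg (coeff n) h
  simp only [coeff_trisect, podSeries, coeff_mk, map_zero] at hn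
  convert hn using 3
  ring

theorem pod_twentyseven_mul_add_seventeen (n : ℕ) :
    (pod (27 * n + 17) : ZMod 3) = -pod (3 * n + 2) := by
  have h : trisect 1 (trisect 2 (trisect 2 podSeries)) = -trisect 2 podSeries := by
    rw [trisect_two_trisect_two_podSeries, (trisect_mul_expand _ _).1, trisect_one_psiNeg,
      trisect_two_podSeries]
    ring
  have hn := congrArg (coeff n) h
  simp only [coeff_trisect, podSeries, coeff_mk, map_neg] at hn
  rw [← hn]
  congr 2
  ring

theorem pod_cong_23 (n α : ℕ) :
    pod (3 ^ (2 * α + 3) * n + (23 * 3 ^ (2 * α + 2) + 1) / 8) ≡ 0 [MOD 3] := by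
  rw [← ZMod.natCast_eq_natCast_iff, Nat.cast_zero]
  induction α with
  | zero => exact pod_twentyseven_mul_add_twentysix n
  | succ α ih =>
    have h9 : 3 ^ (2 * α + 2) % 8 = 1 := by
      rw [show 2 * α + 2 = 2 * (α + 1) by ring, pow_mul, Nat.pow_mod]
      simp
    have h1 : 3 ^ (2 * α + 3) = 3 * 3 ^ (2 * α + 2) := pow_succ' ..
    have h2 : 3 ^ (2 * (α + 1) + 3) = 27 * 3 ^ (2 * α + 2) := by ring
    have h3 : 3 ^ (2 * (α + 1) + 2) = 9 * 3 ^ (2 * α + 2) := by ring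
    have hd : 3 ∣ 3 ^ (2 * α + 2) := dvd_pow_self 3 (by omega)
    rw [h1] at ih
    rw [h2, h3]
    generalize 3 ^ (2 * α + 2) = t at *
    obtain ⟨m, hm⟩ : ∃ m, (23 * t + 1) / 8 = 3 * m + 2 := ⟨(23 * t + 1) / 8 / 3, by omega⟩
    have hm' : (23 * (9 * t) + 1) / 8 = 27 * m + 17 := by omega
    rw [hm, show 3 * t * n + (3 * m + 2) = 3 * (t * n + m) + 2 by ring] at ih
    rw [hm', show 27 * t * n + (27 * m + 17) = 27 * (t * n + m) + 17 by ring,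
      pod_twentyseven_mul_add_seventeen, ih, neg_zero]
end

section
/- For all integers n ≥ 0, there are no triples (x, y, z) ∈ ℤ³ with x² + y² + 3z² = 9n + 6, and consequently r₅(9n+6) ≡ 0 (mod 3). -/
/-- `r₅(n)`: number of representations of `n` as a sum of five squares. -/
noncomputable def r5 (n : ℕ) : ℕ :=
  Nat.card {x : ℤ × ℤ × ℤ × ℤ × ℤ //
    x.1 ^ 2 + x.2.1 ^ 2 + x.2.2.1 ^ 2 + x.2.2.2.1 ^ 2 + x.2.2.2.2 ^ 2 = (n : ℤ)}

/-- A type with a fixed-point-free self-map of order three has cardinality divisible by three. -/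
theorem card_modEq_zero_of_iterate_three {α : Type*} (f : α → α)
    (hf : f^[3] = id) (hfix : ∀ a, f a ≠ a) : Nat.card α ≡ 0 [MOD 3] := by
  classical
  cases finite_or_infinite α with
  | inr h => simp [Nat.ModEq]
  | inl h =>
    have : Fintype α := Fintype.ofFinite α
    have : Fact (Nat.Prime 3) := ⟨Nat.prime_three⟩
    let g : Function.End α := f
    have hpow : g ^ 3 ^ 1 = 1 := hf
    have hempty : IsEmpty (Function.fixedPoints g) := ⟨fun a => hfix a a.2⟩
    have key := Equiv.Perm.card_fixedPoints_modEq hpow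
    rw [Nat.card_eq_fintype_card]
    exact key.trans (by rw [Fintype.card_eq_zero_iff.mpr hempty])

theorem sq_add_sq_add_three_mul_sq_ne (n x y z : ℤ) :
    x ^ 2 + y ^ 2 + 3 * z ^ 2 ≠ 9 * n + 6 := by
  intro h
  have hsq (a : ℤ) : a ^ 2 % 3 = 0 ∧ 3 ∣ a ∨ a ^ 2 % 3 = 1 := by
    rcases (by omega : a % 3 = 0 ∨ a % 3 = 1 ∨ a % 3 = 2) with ha | ha | ha <;>
      simp [pow_two, Int.mul_emod, ha, Int.dvd_iff_emod_eq_zero]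
  have hx := hsq x
  have hy := hsq y
  have hz := hsq z
  obtain ⟨a, rfl⟩ : 3 ∣ x := by omega
  obtain ⟨b, rfl⟩ : 3 ∣ y := by omega
  have ha : (3 * a) ^ 2 = 9 * a ^ 2 := by ring
  have hb : (3 * b) ^ 2 = 9 * b ^ 2 := by ring
  omega

theorem no_rep_and_r5_cong (n : ℕ) :
    (¬ ∃ x y z : ℤ, x ^ 2 + y ^ 2 + 3 * z ^ 2 = 9 * (n : ℤ) + 6) ∧
      r5 (9 * n + 6) ≡ 0 [MOD 3] := by
  refine ⟨fun ⟨x, y, z, h⟩ => sq_add_sq_add_three_mul_sq_ne n x y z h, ?_⟩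
  refine card_modEq_zero_of_iterate_three
    (fun ⟨(a, b, c, d, e), h⟩ => ⟨(a, b, d, e, c), by dsimp only at h ⊢; linarith⟩) rfl ?_
  rintro ⟨⟨a, b, c, d, e⟩, h⟩ hfix
  simp only [Subtype.mk.injEq, Prod.mk.injEq, true_and] at hfix
  obtain ⟨rfl, rfl, -⟩ := hfix
  refine sq_add_sq_add_three_mul_sq_ne n a b e ?_
  push_cast at h
  linarith
end
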